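/- There exists exactly one family of ℚ-bilinear maps ∘ₙ : A[X] × A[X] → A[X] (n ∈ ℕ) satisfying, for all p, q ∈ A[X], all a, b ∈ A and all n ∈ ℕ: (X·p) ∘ₙ q = −n·(p ∘_{n−1} q) (interpreted as 0 when n = 0); p ∘ₙ (X·q) = X·(p ∘ₙ q) + n·(p ∘_{n−1} q); and (C a) ∘ₙ (C b) = C(a·∂ⁿ(b)). Moreover, this family satisfies locality (for all p, q ∈ A[X] there is N with p ∘ₙ q = 0 for all n ≥ N) and conformal associativity: (p ∘ₙ q) ∘ₘ r = Σ_{s=0}^{n} (−1)^s (n choose s) · p ∘_{n−s} (q ∘_{m+s} r) for all p, q, r ∈ A[X] and n, m ∈ ℕ. -/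

import Mathlib

open Polynomial

theorem Polynomial.induction_C_add_X_mul {R : Type*} [Semiring R] {P : R[X] → Prop} (p : R[X])
    (C : ∀ a, P (C a)) (add : ∀ p q, P p → P q → P (p + q)) (X_mul : ∀ p, P p → P (X * p)) :
    P p := by
  induction p using Polynomial.induction_on' with
  | add p q hp hq => exact add p q hp hq
  | monomial n a =>
    induction n with
    | zero => exact C a
    | succ n ih => exact X_mul_monomial n a ▸ X_mul _ ih

section

variable {A : Type*} [Ring A] [Algebra ℚ A]

/-- The operator on `A[X]` applying `d` to each coefficient and adding the formal derivative. -/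
noncomputable def totalDerivative (d : A →ₗ[ℚ] A) : Module.End ℚ A[X] :=
  Polynomial.lsum (fun i => (monomial i).restrictScalars ℚ ∘ₗ d) + derivative.restrictScalars ℚ

theorem totalDerivative_monomial (d : A →ₗ[ℚ] A) (i : ℕ) (a : A) :
    totalDerivative d (monomial i a) = monomial i (d a) + derivative (monomial i a) := by
  simp [totalDerivative, Polynomial.lsum_apply, sum_monomial_index]

theorem totalDerivative_C (d : A →ₗ[ℚ] A) (a : A) : totalDerivative d (C a) = C (d a) := by
  simpa using totalDerivative_monomial d 0 a

theorem totalDerivative_X_mul (d : A →ₗ[ℚ] A) (p : A[X]) :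
    totalDerivative d (X * p) = X * totalDerivative d p + p := by
  induction p using Polynomial.induction_on' with
  | add p q hp hq => rw [mul_add, map_add, map_add, hp, hq, mul_add]; abel
  | monomial n a =>
    rw [X_mul_monomial, totalDerivative_monomial, totalDerivative_monomial, mul_add,
      X_mul_monomial, ← X_mul_monomial n a, derivative_mul, derivative_X, one_mul]
    abel

theorem totalDerivative_C_mul {d : A →ₗ[ℚ] A} (hder : ∀ x y : A, d (x * y) = d x * y + x * d y)
    (a : A) (p : A[X]) :
    totalDerivative d (C a * p) = C (d a) * p + C a * totalDerivative d p := by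
  induction p using Polynomial.induction_C_add_X_mul with
  | C b => simp only [← C_mul, ← C_add, totalDerivative_C, hder]
  | add p q hp hq => simp only [mul_add, map_add, hp, hq]; abel
  | X_mul p ih =>
    rw [← mul_assoc, ← X_mul_C, mul_assoc, totalDerivative_X_mul, totalDerivative_X_mul, ih]
    simp only [mul_add, ← mul_assoc, X_mul_C]
    abel

theorem totalDerivative_pow_C (d : A →ₗ[ℚ] A) (n : ℕ) (a : A) :
    (totalDerivative d ^ n) (C a) = C ((⇑d)^[n] a) := by
  induction n with
  | zero => simp
  | succ n ih =>
    rw [pow_succ', Module.End.mul_apply, ih, totalDerivative_C, Function.iterate_succ_apply']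

theorem totalDerivative_pow_X_mul (d : A →ₗ[ℚ] A) (n : ℕ) (p : A[X]) :
    (totalDerivative d ^ n) (X * p) =
      X * (totalDerivative d ^ n) p + (n : ℚ) • (totalDerivative d ^ (n - 1)) p := by
  induction n with
  | zero => simp
  | succ n ih =>
    rw [pow_succ', Module.End.mul_apply, ih, map_add, totalDerivative_X_mul, map_smul,
      Module.End.mul_apply, Nat.add_sub_cancel]
    rcases n with _ | n
    · simp
    · rw [Nat.add_sub_cancel, ← Module.End.mul_apply _ (_ ^ n), ← pow_succ']
      push_cast
      module

theorem exists_totalDerivative_pow_eq_zero {d : A →ₗ[ℚ] A}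
    (hnil : ∀ a : A, ∃ N : ℕ, (⇑d)^[N] a = 0) (p : A[X]) :
    ∃ N : ℕ, ∀ n ≥ N, (totalDerivative d ^ n) p = 0 := by
  induction p using Polynomial.induction_C_add_X_mul with
  | C a =>
    obtain ⟨N, hN⟩ := hnil a
    refine ⟨N, fun n hn => ?_⟩
    obtain ⟨k, rfl⟩ := Nat.exists_eq_add_of_le' hn
    rw [pow_add, Module.End.mul_apply, totalDerivative_pow_C, hN, C_0, map_zero]
  | add p q hp hq =>
    obtain ⟨M, hM⟩ := hp
    obtain ⟨N, hN⟩ := hq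
    refine ⟨max M N, fun n hn => ?_⟩
    rw [map_add, hM n (le_of_max_le_left hn), hN n (le_of_max_le_right hn), add_zero]
  | X_mul p ih =>
    obtain ⟨N, hN⟩ := ih
    refine ⟨N + 1, fun n hn => ?_⟩
    rw [totalDerivative_pow_X_mul, hN n (by lia), hN (n - 1) (by lia), mul_zero, smul_zero,
      add_zero]

/-- The sesquilinear products on `A[X]` extending `C a ∘ₙ C b = C (a * dⁿ b)`. -/
structure IsConformalProduct (d : A →ₗ[ℚ] A) (mul : ℕ → A[X] →ₗ[ℚ] A[X] →ₗ[ℚ] A[X]) :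
    Prop where
  X_mul_left : ∀ (p q : A[X]) (n : ℕ), mul n (X * p) q = -(n : ℚ) • mul (n - 1) p q
  X_mul_right : ∀ (p q : A[X]) (n : ℕ),
    mul n p (X * q) = X * mul n p q + (n : ℚ) • mul (n - 1) p q
  C_C : ∀ (a b : A) (n : ℕ), mul n (C a) (C b) = C (a * (⇑d)^[n] b)

/-- The products
`p ∘ₙ q = ∑ i, (-1) ^ i * n (n - 1) ⋯ (n - i + 1) * pᵢ * totalDerivative d ^ (n - i) q`. -/
noncomputable def conformalProduct (d : A →ₗ[ℚ] A) (n : ℕ) : A[X] →ₗ[ℚ] A[X] →ₗ[ℚ] A[X] :=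
  LinearMap.mk₂ ℚ
    (fun p q => ∑ i ∈ Finset.range (n + 1), ((-1 : ℚ) ^ i * (n.descFactorial i : ℚ)) •
      (C (p.coeff i) * (totalDerivative d ^ (n - i)) q))
    (fun p p' q => by simp [add_mul, Finset.sum_add_distrib])
    (fun c p q => by
      simp only [coeff_smul, ← smul_C, smul_mul_assoc, Finset.smul_sum, smul_comm c])
    (fun p q q' => by simp [mul_add, Finset.sum_add_distrib])
    (fun c p q => by
      simp only [map_smul, mul_smul_comm, Finset.smul_sum, smul_comm c])

theorem conformalProduct_apply (d : A →ₗ[ℚ] A) (n : ℕ) (p q : A[X]) :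
    conformalProduct d n p q =
      ∑ i ∈ Finset.range (n + 1), ((-1 : ℚ) ^ i * (n.descFactorial i : ℚ)) •
        (C (p.coeff i) * (totalDerivative d ^ (n - i)) q) :=
  rfl

theorem isConformalProduct_conformalProduct (d : A →ₗ[ℚ] A) :
    IsConformalProduct d (conformalProduct d) where
  X_mul_left p q n := by
    rcases n with _ | n
    · simp [conformalProduct_apply]
    · rw [conformalProduct_apply, conformalProduct_apply, Finset.sum_range_succ',
        Finset.smul_sum, coeff_X_mul_zero, C_0, zero_mul, smul_zero, add_zero,
        Nat.add_sub_cancel]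
      refine Finset.sum_congr rfl fun i _ => ?_
      rw [coeff_X_mul, Nat.succ_descFactorial_succ, Nat.add_sub_add_right, smul_smul]
      congr 1
      push_cast
      ring
  X_mul_right p q n := by
    have key (i : ℕ) (a : A) : C a * (totalDerivative d ^ (n - i)) (X * q) =
        X * (C a * (totalDerivative d ^ (n - i)) q) +
          ((n - i : ℕ) : ℚ) • (C a * (totalDerivative d ^ (n - 1 - i)) q) := by
      rw [totalDerivative_pow_X_mul, mul_add, ← mul_assoc, ← X_mul_C, mul_assoc, mul_smul_comm,
        Nat.sub_right_comm]
    simp only [conformalProduct_apply, key, smul_add, Finset.sum_add_distrib, Finset.mul_sum,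
      mul_smul_comm, add_right_inj]
    rcases n with _ | n
    · simp
    · rw [Finset.sum_range_succ, Nat.sub_self, Nat.cast_zero, zero_smul, smul_zero, add_zero,
        Nat.add_sub_cancel, Finset.smul_sum]
      refine Finset.sum_congr rfl fun i _ => ?_
      have h : (n + 1 - i) * (n + 1).descFactorial i = (n + 1) * n.descFactorial i := by
        rw [← Nat.descFactorial_succ, Nat.succ_descFactorial_succ]
      have h' : ((n + 1 - i : ℕ) : ℚ) * ((n + 1).descFactorial i : ℚ) =
          ((n + 1 : ℕ) : ℚ) * (n.descFactorial i : ℚ) := mod_cast h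
      rw [smul_smul, smul_smul]
      congr 1
      linear_combination (-1 : ℚ) ^ i * h'
  C_C a b n := by
    rw [conformalProduct_apply, Finset.sum_range_succ']
    simp [totalDerivative_pow_C]

namespace IsConformalProduct

variable {d : A →ₗ[ℚ] A} {mul mul' : ℕ → A[X] →ₗ[ℚ] A[X] →ₗ[ℚ] A[X]}

theorem C_left (h : IsConformalProduct d mul) (n : ℕ) (a : A) (q : A[X]) :
    mul n (C a) q = C a * (totalDerivative d ^ n) q := by
  induction q using Polynomial.induction_C_add_X_mul generalizing n with
  | C b => rw [h.C_C, totalDerivative_pow_C, C_mul]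
  | add p q hp hq => rw [map_add, map_add, hp, hq, mul_add]
  | X_mul q ih =>
    rw [h.X_mul_right, ih, ih, totalDerivative_pow_X_mul, mul_add, ← mul_assoc, X_mul_C,
      mul_assoc, mul_smul_comm]

theorem unique (h : IsConformalProduct d mul) (h' : IsConformalProduct d mul') : mul = mul' := by
  ext1 n
  refine LinearMap.ext₂ fun p q => ?_
  induction p using Polynomial.induction_C_add_X_mul generalizing n with
  | C a => rw [h.C_left, h'.C_left]
  | add p p' hp hp' => simp only [map_add, LinearMap.add_apply, hp, hp']
  | X_mul p ih => rw [h.X_mul_left, h'.X_mul_left, ih]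

theorem C_mul_left (h : IsConformalProduct d mul) (n : ℕ) (a : A) (p q : A[X]) :
    mul n (C a * p) q = C a * mul n p q := by
  induction p using Polynomial.induction_C_add_X_mul generalizing n with
  | C b => rw [← C_mul, h.C_left, h.C_left, C_mul, mul_assoc]
  | add p p' hp hp' => simp only [mul_add, map_add, LinearMap.add_apply, hp, hp']
  | X_mul p ih =>
    rw [← mul_assoc, ← X_mul_C, mul_assoc, h.X_mul_left, h.X_mul_left, ih, mul_smul_comm]

theorem locality (h : IsConformalProduct d mul) (hnil : ∀ a : A, ∃ N : ℕ, (⇑d)^[N] a = 0)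
    (p q : A[X]) : ∃ N : ℕ, ∀ n ≥ N, mul n p q = 0 := by
  induction p using Polynomial.induction_C_add_X_mul with
  | C a =>
    obtain ⟨N, hN⟩ := exists_totalDerivative_pow_eq_zero hnil q
    exact ⟨N, fun n hn => by rw [h.C_left, hN n hn, mul_zero]⟩
  | add p p' hp hp' =>
    obtain ⟨M, hM⟩ := hp
    obtain ⟨N, hN⟩ := hp'
    refine ⟨max M N, fun n hn => ?_⟩
    rw [map_add, LinearMap.add_apply, hM n (le_of_max_le_left hn),
      hN n (le_of_max_le_right hn), add_zero]
  | X_mul p ih =>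
    obtain ⟨N, hN⟩ := ih
    exact ⟨N + 1, fun n hn => by rw [h.X_mul_left, hN (n - 1) (by lia), smul_zero]⟩

theorem totalDerivative_left (h : IsConformalProduct d mul)
    (hder : ∀ x y : A, d (x * y) = d x * y + x * d y) (n : ℕ) (p q : A[X]) :
    mul n (totalDerivative d p) q = totalDerivative d (mul n p q) - mul (n + 1) p q := by
  induction p using Polynomial.induction_C_add_X_mul generalizing n with
  | C a =>
    rw [totalDerivative_C, h.C_left, h.C_left, h.C_left, totalDerivative_C_mul hder, pow_succ',
      Module.End.mul_apply, add_sub_cancel_right]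
  | add p p' hp hp' => simp only [map_add, LinearMap.add_apply, hp, hp']; abel
  | X_mul p ih =>
    rw [totalDerivative_X_mul, map_add, LinearMap.add_apply, h.X_mul_left, h.X_mul_left,
      h.X_mul_left, ih, map_smul, Nat.add_sub_cancel]
    rcases n with _ | n
    · simp
    · rw [Nat.add_sub_cancel]
      push_cast
      module

theorem totalDerivative_pow_left (h : IsConformalProduct d mul)
    (hder : ∀ x y : A, d (x * y) = d x * y + x * d y) (n m : ℕ) (p q : A[X]) :
    mul m ((totalDerivative d ^ n) p) q =
      ∑ s ∈ Finset.range (n + 1), ((-1 : ℚ) ^ s * (n.choose s : ℚ)) •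
        (totalDerivative d ^ (n - s)) (mul (m + s) p q) := by
  -- `E` applies `totalDerivative d` to each term of a sequence and `S` shifts the sequence.
  let E : Module.End ℚ (ℕ → A[X]) := (totalDerivative d).compLeft ℕ
  let S : Module.End ℚ (ℕ → A[X]) := LinearMap.funLeft ℚ A[X] (· + 1)
  have hE (k : ℕ) (f : ℕ → A[X]) (m : ℕ) : (E ^ k) f m = (totalDerivative d ^ k) (f m) := by
    induction k with
    | zero => rfl
    | succ k ih =>
      rw [pow_succ', pow_succ', Module.End.mul_apply, Module.End.mul_apply, ← ih]; rfl
  have hS (k : ℕ) (f : ℕ → A[X]) (m : ℕ) : (S ^ k) f m = f (m + k) := by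
    induction k generalizing m with
    | zero => rfl
    | succ k ih =>
      rw [pow_succ', Module.End.mul_apply, LinearMap.funLeft_apply, ih, add_right_comm, add_assoc]
  have hES : Commute ((-1 : ℚ) • S) E :=
    Commute.smul_left (show S * E = E * S from rfl) _
  have hpow : (fun k => mul k ((totalDerivative d ^ n) p) q) =
      (((-1 : ℚ) • S + E) ^ n) (fun k => mul k p q) := by
    induction n with
    | zero => rfl
    | succ n ih =>
      rw [pow_succ' (_ + E), Module.End.mul_apply, ← ih]
      ext1 k
      rw [pow_succ', Module.End.mul_apply, h.totalDerivative_left hder]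
      simp [E, S, LinearMap.funLeft_apply, sub_eq_neg_add]
  rw [congrFun hpow m, hES.add_pow, LinearMap.sum_apply, Finset.sum_apply]
  refine Finset.sum_congr rfl fun s _ => ?_
  rw [← nsmul_eq_mul', LinearMap.smul_apply, Pi.smul_apply, _root_.smul_pow,
    smul_mul_assoc, LinearMap.smul_apply, Pi.smul_apply, Module.End.mul_apply, hS, hE, ← Nat.cast_smul_eq_nsmul ℚ, smul_smul, mul_comm]

theorem assoc (h : IsConformalProduct d mul)
    (hder : ∀ x y : A, d (x * y) = d x * y + x * d y) (p q r : A[X]) (n m : ℕ) :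
    mul m (mul n p q) r =
      ∑ s ∈ Finset.range (n + 1),
        ((-1 : ℚ) ^ s * (n.choose s : ℚ)) • mul (n - s) p (mul (m + s) q r) := by
  induction p using Polynomial.induction_C_add_X_mul generalizing n with
  | C a =>
    simp only [h.C_left, h.C_mul_left, h.totalDerivative_pow_left hder, Finset.mul_sum,
      mul_smul_comm]
  | add p p' hp hp' =>
    simp only [map_add, LinearMap.add_apply, hp, hp', smul_add, Finset.sum_add_distrib]
  | X_mul p ih =>
    simp only [h.X_mul_left, map_smul, LinearMap.smul_apply]
    rcases n with _ | n
    · simp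
    · rw [Nat.add_sub_cancel, ih, Finset.sum_range_succ _ (n + 1), Nat.sub_self, Nat.cast_zero,
        neg_zero, zero_smul, smul_zero, add_zero, Finset.smul_sum]
      refine Finset.sum_congr rfl fun s _ => ?_
      have hc : (n.choose s : ℚ) * ((n + 1 : ℕ) : ℚ) =
          ((n + 1).choose s : ℚ) * ((n + 1 - s : ℕ) : ℚ) := mod_cast Nat.choose_mul_succ_eq n s
      rw [smul_smul, smul_smul, Nat.sub_right_comm, Nat.add_sub_cancel]
      congr 1
      linear_combination -(-1 : ℚ) ^ s * hc

end IsConformalProduct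

end

theorem unique_conformal_products_no_sign
    (A : Type*) [Ring A] [Algebra ℚ A]
    (d : A →ₗ[ℚ] A)
    (hder : ∀ x y : A, d (x * y) = d x * y + x * d y)
    (hnil : ∀ a : A, ∃ N : ℕ, (⇑d)^[N] a = 0) :
    (∃! mul : ℕ → A[X] →ₗ[ℚ] A[X] →ₗ[ℚ] A[X],
      (∀ (p q : A[X]) (n : ℕ), mul n (X * p) q = -(n : ℚ) • mul (n - 1) p q) ∧
      (∀ (p q : A[X]) (n : ℕ),
        mul n p (X * q) = X * mul n p q + (n : ℚ) • mul (n - 1) p q) ∧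
      (∀ (a b : A) (n : ℕ),
        mul n (C a) (C b) = C (a * (⇑d)^[n] b))) ∧
    (∀ mul : ℕ → A[X] →ₗ[ℚ] A[X] →ₗ[ℚ] A[X],
      ((∀ (p q : A[X]) (n : ℕ), mul n (X * p) q = -(n : ℚ) • mul (n - 1) p q) ∧
       (∀ (p q : A[X]) (n : ℕ),
         mul n p (X * q) = X * mul n p q + (n : ℚ) • mul (n - 1) p q) ∧
       (∀ (a b : A) (n : ℕ),
         mul n (C a) (C b) = C (a * (⇑d)^[n] b))) →
      -- locality
      (∀ p q : A[X], ∃ N : ℕ, ∀ n ≥ N, mul n p q = 0) ∧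
      -- conformal associativity
      (∀ (p q r : A[X]) (n m : ℕ),
        mul m (mul n p q) r =
          ∑ s ∈ Finset.range (n + 1),
            ((-1 : ℚ) ^ s * (n.choose s : ℚ)) • mul (n - s) p (mul (m + s) q r))) := by
  have H := isConformalProduct_conformalProduct d
  refine ⟨⟨conformalProduct d, ⟨H.X_mul_left, H.X_mul_right, H.C_C⟩, ?_⟩, ?_⟩
  · rintro mul ⟨h₁, h₂, h₃⟩
    exact IsConformalProduct.unique ⟨h₁, h₂, h₃⟩ H
  · rintro mul ⟨h₁, h₂, h₃⟩
    have h : IsConformalProduct d mul := ⟨h₁, h₂, h₃⟩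
    exact ⟨h.locality hnil, h.assoc hder⟩
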